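/- Let F_q be a finite field with q elements and l a finite field extension of F_q. Then the pairing l((t))^* × l((t))^* → F_q^*, (f,g) ↦ Nm_{l/F_q}((f,g)_t), induces a well-defined unimodular pairing on the quotient group l((t))^*/(l((t))^*)^{q-1}, i.e., the induced map from l((t))^*/(l((t))^*)^{q-1} to Hom(l((t))^*/(l((t))^*)^{q-1}, F_q^*) is a group isomorphism. -/

import Mathlib

/-- The tame symbol `(f,g)_t = ((-1)^{v(f)v(g)} f^{-v(g)} g^{v(f)})(0)` of two Laurent series,
where `v` is the `t`-adic valuation (the order) and `(0)` takes the constant term. -/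
noncomputable def tameSymbol {l : Type*} [Field l] (f g : LaurentSeries l) : l :=
  (((-1 : LaurentSeries l) ^ (f.order * g.order)) * f ^ (-g.order) * g ^ f.order).coeff 0

/-- The subgroup of `n`-th powers of a commutative group. -/
def powSubgroup (G : Type*) [CommGroup G] (n : ℕ) : Subgroup G :=
  (powMonoidHom n : G →* G).range

/-- Hensel's lemma for `n`-th roots: a power series whose constant term is an `n`-th power, with
`n` invertible, is an `n`-th power. -/
theorem PowerSeries.exists_pow_eq_of_constantCoeff_eq_pow {l : Type*} [Field l] {n : ℕ}
    (hn : (n : l) ≠ 0) {b : l} (hb : b ≠ 0) (u : PowerSeries l)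
    (hu : PowerSeries.constantCoeff u = b ^ n) : ∃ w : PowerSeries l, w ^ n = u := by
  have hn0 : n ≠ 0 := by rintro rfl; simp at hn
  obtain ⟨w, hw, -⟩ := HenselianRing.is_henselian
    (I := Ideal.span {(PowerSeries.X : PowerSeries l)})
    (Polynomial.X ^ n - Polynomial.C u) (Polynomial.monic_X_pow_sub_C u hn0) (PowerSeries.C b)
    (by
      rw [Ideal.mem_span_singleton, PowerSeries.X_dvd_iff]
      simp [hu])
    (by
      apply IsUnit.map
      rw [PowerSeries.isUnit_iff_constantCoeff]
      simp [Polynomial.derivative_X_pow, hn, hb])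
  exact ⟨w, by simpa [sub_eq_zero] using hw⟩

namespace LaurentSeries

variable {l : Type*} [Field l]

/-- The `t`-adic valuation as a homomorphism on the units of `l((t))`. -/
noncomputable def unitsOrder : (LaurentSeries l)ˣ →* Multiplicative ℤ :=
  MonoidHom.mk' (fun f ↦ .ofAdd (f : LaurentSeries l).order) fun f g ↦ by
    rw [Units.val_mul, HahnSeries.order_mul f.ne_zero g.ne_zero, ofAdd_add]

/-- The leading coefficient as a homomorphism on the units of `l((t))`. -/
noncomputable def unitsLeadingCoeff : (LaurentSeries l)ˣ →* lˣ :=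
  Units.map
    { toFun := HahnSeries.leadingCoeff
      map_one' := HahnSeries.leadingCoeff_one
      map_mul' := fun f g ↦ HahnSeries.leadingCoeff_mul f g }

theorem val_unitsLeadingCoeff (f : (LaurentSeries l)ˣ) :
    (unitsLeadingCoeff f : l) = (f : LaurentSeries l).leadingCoeff := rfl

theorem toAdd_unitsOrder (f : (LaurentSeries l)ˣ) :
    (unitsOrder f).toAdd = (f : LaurentSeries l).order := rfl

theorem mem_powSubgroup_of_order_of_leadingCoeff {n : ℕ} (hn : (n : l) ≠ 0)
    (f : (LaurentSeries l)ˣ) (hord : (n : ℤ) ∣ (f : LaurentSeries l).order)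
    (hlc : unitsLeadingCoeff f ∈ powSubgroup lˣ n) : f ∈ powSubgroup (LaurentSeries l)ˣ n := by
  have hn0 : n ≠ 0 := by rintro rfl; simp at hn
  obtain ⟨m, hm⟩ := hord
  obtain ⟨b, hb⟩ := hlc
  have hb' : (b : l) ^ n = (f : LaurentSeries l).coeff (f : LaurentSeries l).order := by
    rw [← HahnSeries.leadingCoeff_eq, ← val_unitsLeadingCoeff, ← hb]
    simp
  obtain ⟨w, hw⟩ := PowerSeries.exists_pow_eq_of_constantCoeff_eq_pow hn b.ne_zero
    (f : LaurentSeries l).powerSeriesPart (by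
      rw [← PowerSeries.coeff_zero_eq_constantCoeff_apply, powerSeriesPart_coeff, hb']
      simp)
  have key : (HahnSeries.single m (1 : l) * HahnSeries.ofPowerSeries ℤ l w) ^ n = f := by
    rw [mul_pow, ← map_pow (HahnSeries.ofPowerSeries ℤ l), hw, HahnSeries.single_pow, one_pow, nsmul_eq_mul, ← hm,
      single_order_mul_powerSeriesPart]
  have hne : HahnSeries.single m (1 : l) * HahnSeries.ofPowerSeries ℤ l w ≠ 0 := by
    intro h
    rw [h, zero_pow hn0] at key
    exact f.ne_zero key.symm
  exact ⟨Units.mk0 _ hne, Units.ext (by simpa using key)⟩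

theorem finite_quotient_powSubgroup [Finite l] {n : ℕ} (hn : (n : l) ≠ 0) :
    Finite ((LaurentSeries l)ˣ ⧸ powSubgroup (LaurentSeries l)ˣ n) := by
  have hn0 : NeZero n := ⟨by rintro rfl; simp at hn⟩
  let φ : (LaurentSeries l)ˣ →* Multiplicative (ZMod n) × lˣ :=
    ((AddMonoidHom.toMultiplicative (Int.castAddHom (ZMod n))).comp unitsOrder).prod
      unitsLeadingCoeff
  have hle : φ.ker ≤ powSubgroup (LaurentSeries l)ˣ n := by
    intro f hf
    obtain ⟨h1, h2⟩ := Prod.ext_iff.1 (MonoidHom.mem_ker.1 hf)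
    refine mem_powSubgroup_of_order_of_leadingCoeff hn f ?_ ?_
    · exact (ZMod.intCast_zmod_eq_zero_iff_dvd _ n).1 h1
    · exact (show unitsLeadingCoeff f = 1 from h2) ▸ one_mem _
  have : φ.ker.FiniteIndex := inferInstance
  have := Subgroup.finiteIndex_of_le hle
  exact Subgroup.finite_quotient_of_finiteIndex

/-- The tame symbol as a bilinear pairing with values in the units. -/
noncomputable def unitsTameSymbol : (LaurentSeries l)ˣ →* (LaurentSeries l)ˣ →* lˣ :=
  MonoidHom.mk' (fun f ↦ MonoidHom.mk' (fun g ↦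
      (-1) ^ ((unitsOrder f).toAdd * (unitsOrder g).toAdd) *
        unitsLeadingCoeff f ^ (-(unitsOrder g).toAdd) *
        unitsLeadingCoeff g ^ (unitsOrder f).toAdd)
      fun g h ↦ by
        ext
        simp only [map_mul, toAdd_mul, mul_add, neg_add, zpow_add, mul_zpow, Units.val_mul]
        ring)
    fun f g ↦ by
      ext h
      simp only [map_mul, toAdd_mul, add_mul, zpow_add, mul_zpow, MonoidHom.mk'_apply,
        MonoidHom.mul_apply, Units.val_mul]
      ring

theorem unitsTameSymbol_apply (f g : (LaurentSeries l)ˣ) :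
    unitsTameSymbol f g = (-1) ^ ((unitsOrder f).toAdd * (unitsOrder g).toAdd) *
        unitsLeadingCoeff f ^ (-(unitsOrder g).toAdd) *
        unitsLeadingCoeff g ^ (unitsOrder f).toAdd := rfl

theorem unitsLeadingCoeff_neg_one : unitsLeadingCoeff (-1 : (LaurentSeries l)ˣ) = -1 := by
  ext
  simp [val_unitsLeadingCoeff, HahnSeries.leadingCoeff_eq]

theorem toAdd_unitsOrder_neg_one : (unitsOrder (-1 : (LaurentSeries l)ˣ)).toAdd = 0 := by
  simp [toAdd_unitsOrder]

theorem val_unitsTameSymbol (f g : (LaurentSeries l)ˣ) :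
    (unitsTameSymbol f g : l) = tameSymbol (f : LaurentSeries l) (g : LaurentSeries l) := by
  set h : (LaurentSeries l)ˣ := (-1) ^ ((unitsOrder f).toAdd * (unitsOrder g).toAdd) *
    f ^ (-(unitsOrder g).toAdd) * g ^ (unitsOrder f).toAdd with hh
  have hsym : unitsTameSymbol f g = unitsLeadingCoeff h := by
    rw [unitsTameSymbol_apply, hh]
    simp only [map_mul, map_zpow, unitsLeadingCoeff_neg_one]
  have hord : (h : LaurentSeries l).order = 0 := by
    rw [← toAdd_unitsOrder, hh]
    simp only [map_mul, map_zpow, toAdd_mul, toAdd_zpow, toAdd_unitsOrder_neg_one, smul_eq_mul]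
    ring
  have hval : (h : LaurentSeries l).coeff 0 =
      tameSymbol (f : LaurentSeries l) (g : LaurentSeries l) := by
    simp [hh, tameSymbol, toAdd_unitsOrder]
  rw [hsym, val_unitsLeadingCoeff, HahnSeries.leadingCoeff_eq, hord, hval]

theorem unitsTameSymbol_mul_swap (f g : (LaurentSeries l)ˣ) :
    unitsTameSymbol f g * unitsTameSymbol g f = 1 := by
  have hsign (k : ℤ) : ((-1 : lˣ) ^ k) * (-1) ^ k = 1 := by
    rw [← mul_zpow]; simp
  rw [unitsTameSymbol_apply, unitsTameSymbol_apply, zpow_neg, zpow_neg,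
    mul_comm (unitsOrder g).toAdd]
  calc _ = ((-1 : lˣ) ^ ((unitsOrder f).toAdd * (unitsOrder g).toAdd) *
        (-1) ^ ((unitsOrder f).toAdd * (unitsOrder g).toAdd)) *
        ((unitsLeadingCoeff f ^ (unitsOrder g).toAdd)⁻¹ *
          unitsLeadingCoeff f ^ (unitsOrder g).toAdd) *
        ((unitsLeadingCoeff g ^ (unitsOrder f).toAdd)⁻¹ *
          unitsLeadingCoeff g ^ (unitsOrder f).toAdd) := by ac_rfl
    _ = 1 := by simp [hsign]

theorem exists_unitsOrder_unitsLeadingCoeff (m : ℤ) (a : lˣ) :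
    ∃ g : (LaurentSeries l)ˣ, (unitsOrder g).toAdd = m ∧ unitsLeadingCoeff g = a := by
  refine ⟨Units.mk0 (HahnSeries.single m (a : l)) (by simp), ?_, Units.ext ?_⟩
  · rw [toAdd_unitsOrder, Units.val_mk0, HahnSeries.order_single a.ne_zero]
  · rw [val_unitsLeadingCoeff, Units.val_mk0, HahnSeries.leadingCoeff_of_single]

end LaurentSeries

/-- In a finite cyclic group whose order is divisible by `d`, the elements killed by `|G| / d` are
the `d`-th powers. -/
theorem IsCyclic.mem_powSubgroup_of_pow_eq_one {G : Type*} [CommGroup G] [IsCyclic G] [Finite G]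
    {d : ℕ} (hd : d ∣ Nat.card G) {x : G} (hx : x ^ (Nat.card G / d) = 1) :
    x ∈ powSubgroup G d := by
  have hle : powSubgroup G d ≤ (powMonoidHom (Nat.card G / d) : G →* G).ker := by
    rintro _ ⟨y, rfl⟩
    rw [MonoidHom.mem_ker, powMonoidHom_apply, powMonoidHom_apply, ← pow_mul,
      Nat.mul_div_cancel' hd, pow_card_eq_one']
  have heq := Subgroup.eq_of_le_of_card_ge hle (by
    rw [powSubgroup, IsCyclic.card_powMonoidHom_ker, IsCyclic.card_powMonoidHom_range,
      Nat.gcd_eq_right hd, Nat.gcd_eq_right (Nat.div_dvd_of_dvd hd)])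
  rw [heq]
  exact hx

theorem FiniteField.mem_powSubgroup_of_norm_eq_one {K L : Type*} [Field K] [Field L] [Algebra K L]
    [Finite K] [Finite L] {x : Lˣ} (hx : Units.map (Algebra.norm K (S := L)) x = 1) :
    x ∈ powSubgroup Lˣ (Nat.card K - 1) := by
  have hd : Nat.card K - 1 ∣ Nat.card Lˣ := by
    rw [Nat.card_units, Module.natCard_eq_pow_finrank (K := K) (V := L)]
    exact Nat.sub_one_dvd_pow_sub_one _ _
  refine IsCyclic.mem_powSubgroup_of_pow_eq_one hd (Units.ext ?_)
  have h : Algebra.norm K (x : L) = 1 := congrArg Units.val hx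
  rw [Nat.card_units, Units.val_pow_eq_pow_val, ← FiniteField.algebraMap_norm_eq_pow (K := K), h]
  simp

/-- A bilinear pairing with values in a group killed by `n` descends to the quotients by `n`-th
powers. -/
theorem exists_pairing_quotient_powSubgroup {G A : Type*} [CommGroup G] [CommGroup A] {n : ℕ}
    (hA : ∀ a : A, a ^ n = 1) (φ : G →* G →* A) :
    ∃ p : (G ⧸ powSubgroup G n) →* (G ⧸ powSubgroup G n) →* A,
      ∀ f g : G, p (QuotientGroup.mk f) (QuotientGroup.mk g) = φ f g := by
  have hker (ψ : G →* A) : powSubgroup G n ≤ ψ.ker := by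
    rintro _ ⟨x, rfl⟩
    simp [MonoidHom.mem_ker, hA]
  let ψ : G →* (G ⧸ powSubgroup G n) →* A :=
    MonoidHom.mk' (fun f ↦ QuotientGroup.lift _ (φ f) (hker _)) fun f g ↦ by
      ext x
      simp
  refine ⟨QuotientGroup.lift _ ψ ?_, fun f g ↦ rfl⟩
  rintro _ ⟨x, rfl⟩
  refine MonoidHom.mem_ker.2 (MonoidHom.ext fun y ↦ ?_)
  simp [hA]

theorem bijective_of_injective_pairing {Q M : Type*} [CommGroup Q] [Finite Q] [CommMonoid M]
    {n : ℕ} [NeZero n] [HasEnoughRootsOfUnity M n] (hQ : ∀ x : Q, x ^ n = 1)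
    {p : Q →* Q →* Mˣ} (hp : Function.Injective p) : Function.Bijective p := by
  have := HasEnoughRootsOfUnity.of_dvd M (Monoid.exponent_dvd_of_forall_pow_eq_one hQ)
  have : Finite (Q →* Mˣ) := Finite.of_equiv Q
    (CommGroup.monoidHom_mulEquiv_of_hasEnoughRootsOfUnity Q M).some.symm.toEquiv
  exact hp.bijective_of_nat_card_le (CommGroup.card_monoidHom_of_hasEnoughRootsOfUnity Q M).le

theorem FiniteField.hasEnoughRootsOfUnity_card_sub_one (K : Type*) [Field K] [Fintype K] :
    HasEnoughRootsOfUnity K (Fintype.card K - 1) := by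
  have : NeZero (Fintype.card K - 1) := ⟨Nat.sub_ne_zero_of_lt Fintype.one_lt_card⟩
  refine HasEnoughRootsOfUnity.of_card_le ?_
  have h : rootsOfUnity (Fintype.card K - 1) K = ⊤ := by
    ext x
    simp [mem_rootsOfUnity, Units.ext_iff, FiniteField.pow_card_sub_one_eq_one]
  rw [h, Subgroup.card_top, Nat.card_units, Nat.card_eq_fintype_card]

open LaurentSeries in
theorem mem_powSubgroup_of_norm_unitsTameSymbol_eq_one {K L : Type*} [Field K] [Fintype K]
    [Field L] [Algebra K L] [Finite L] {f : (LaurentSeries L)ˣ}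
    (hf : ∀ g, Units.map (Algebra.norm K (S := L)) (unitsTameSymbol f g) = 1) :
    f ∈ powSubgroup (LaurentSeries L)ˣ (Fintype.card K - 1) := by
  have hcast : ((Fintype.card K - 1 : ℕ) : L) ≠ 0 := by
    rw [Nat.cast_sub Fintype.card_pos, ← map_natCast (algebraMap K L)]
    simp
  have hord : ((Fintype.card K - 1 : ℕ) : ℤ) ∣ (f : LaurentSeries L).order := by
    obtain ⟨c, hc⟩ := IsCyclic.exists_generator (α := Kˣ)
    obtain ⟨a, rfl⟩ := FiniteField.unitsMap_norm_surjective K L c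
    obtain ⟨g, hg, hga⟩ := exists_unitsOrder_unitsLeadingCoeff 0 a
    have h := hf g
    rw [unitsTameSymbol_apply, hg, hga] at h
    simp only [mul_zero, zpow_zero, neg_zero, one_mul, map_zpow] at h
    rw [← orderOf_dvd_iff_zpow_eq_one, orderOf_eq_card_of_forall_mem_zpowers hc,
      Nat.card_units, Nat.card_eq_fintype_card] at h
    exact h
  refine mem_powSubgroup_of_order_of_leadingCoeff hcast f hord ?_
  obtain ⟨g, hg, hga⟩ := exists_unitsOrder_unitsLeadingCoeff 1 (1 : Lˣ)
  have hsign : (-1 : Lˣ) ^ (unitsOrder f).toAdd = 1 := by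
    obtain ⟨m, hm⟩ := hord
    have h1 : (-1 : Lˣ) ^ (Fintype.card K - 1) = 1 := Units.ext (by
      have := congrArg (algebraMap K L)
        (FiniteField.pow_card_sub_one_eq_one (-1 : K) (neg_ne_zero.2 one_ne_zero))
      simpa using this)
    rw [toAdd_unitsOrder, hm, zpow_mul, zpow_natCast, h1, one_zpow]
  have h := hf g
  rw [unitsTameSymbol_apply, hg, hga, mul_one, hsign] at h
  simp only [one_zpow, mul_one, one_mul, zpow_neg, zpow_one, map_inv, inv_eq_one] at h
  simpa using FiniteField.mem_powSubgroup_of_norm_eq_one h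

/-- Let `F_q` be a finite field with `q` elements and `l` a finite field extension of `F_q`.
The pairing `l((t))^* × l((t))^* → F_q^*`, `(f,g) ↦ Nm_{l/F_q}((f,g)_t)`, induces a
well-defined unimodular pairing on `l((t))^*/(l((t))^*)^{q-1}`: there is a bilinear pairing `p`
on the quotient compatible with the tame symbol pairing such that both induced maps to the
homomorphism groups are group isomorphisms. -/
theorem tame_symbol_unimodular_on_quotient {Fq l : Type*} [Field Fq] [Fintype Fq] [Field l]
    [Algebra Fq l] [FiniteDimensional Fq l] :
    ∃ p : ((LaurentSeries l)ˣ ⧸ powSubgroup (LaurentSeries l)ˣ (Fintype.card Fq - 1)) →*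
          ((LaurentSeries l)ˣ ⧸ powSubgroup (LaurentSeries l)ˣ (Fintype.card Fq - 1)) →* Fqˣ,
      (∀ f g : (LaurentSeries l)ˣ,
        ((p (QuotientGroup.mk f) (QuotientGroup.mk g) : Fqˣ) : Fq) =
          Algebra.norm Fq (tameSymbol (f : LaurentSeries l) (g : LaurentSeries l))) ∧
      Function.Bijective ⇑p ∧ Function.Bijective ⇑p.flip := by
  have : Finite l := Module.finite_of_finite Fq
  have : NeZero (Fintype.card Fq - 1) := ⟨Nat.sub_ne_zero_of_lt Fintype.one_lt_card⟩
  have := FiniteField.hasEnoughRootsOfUnity_card_sub_one Fq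
  have hcast : ((Fintype.card Fq - 1 : ℕ) : l) ≠ 0 := by
    rw [Nat.cast_sub Fintype.card_pos, ← map_natCast (algebraMap Fq l)]
    simp
  have := LaurentSeries.finite_quotient_powSubgroup hcast
  obtain ⟨p, hp⟩ := exists_pairing_quotient_powSubgroup (n := Fintype.card Fq - 1)
    (fun a : Fqˣ ↦ Units.ext (by simpa using FiniteField.pow_card_sub_one_eq_one _ a.ne_zero))
    ((Units.map (Algebra.norm Fq (S := l))).compHom.comp LaurentSeries.unitsTameSymbol)
  have hp' (f g : (LaurentSeries l)ˣ) : p (QuotientGroup.mk f) (QuotientGroup.mk g) =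
      Units.map (Algebra.norm Fq (S := l)) (LaurentSeries.unitsTameSymbol f g) := hp f g
  have hinj : Function.Injective p := by
    refine (injective_iff_map_eq_one p).2 fun x hx ↦ ?_
    obtain ⟨f, rfl⟩ := QuotientGroup.mk_surjective x
    refine (QuotientGroup.eq_one_iff f).2
      (mem_powSubgroup_of_norm_unitsTameSymbol_eq_one fun g ↦ ?_)
    rw [← hp', hx, MonoidHom.one_apply]
  have hflip (x y) : p.flip x y = (p x y)⁻¹ := by
    obtain ⟨f, rfl⟩ := QuotientGroup.mk_surjective x
    obtain ⟨g, rfl⟩ := QuotientGroup.mk_surjective y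
    rw [MonoidHom.flip_apply, hp', hp', ← map_inv,
      eq_inv_of_mul_eq_one_left (LaurentSeries.unitsTameSymbol_mul_swap g f)]
  have hinj' : Function.Injective p.flip := fun x y hxy ↦ hinj <| MonoidHom.ext fun z ↦ by
    simpa [hflip] using DFunLike.congr_fun hxy z
  have hQ (x : (LaurentSeries l)ˣ ⧸ powSubgroup (LaurentSeries l)ˣ (Fintype.card Fq - 1)) :
      x ^ (Fintype.card Fq - 1) = 1 := by
    obtain ⟨f, rfl⟩ := QuotientGroup.mk_surjective x
    exact (QuotientGroup.eq_one_iff _).2 ⟨f, rfl⟩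
  refine ⟨p, fun f g ↦ ?_, bijective_of_injective_pairing hQ hinj,
    bijective_of_injective_pairing hQ hinj'⟩
  rw [hp', Units.coe_map, ← LaurentSeries.val_unitsTameSymbol]
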